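/- Let x ∈ ℝ^m have support N := {i : x_i ≠ 0}, let T ⊆ {1,…,m} and set Δ := N \ T and Δ_e := T \ N. Let y = A x + w ∈ ℝ^n with ‖w‖₂ ≤ ε. If some δ < √2 − 1 is an (|N| + |Δ| + |Δ_e|)-restricted isometry bound for A, then every modified-CS estimate x̂ with known part T computed from y satisfies ‖x − x̂‖₂ ≤ C₁(δ)·ε. -/

import Mathlib

open Finset

attribute [local instance] Classical.propDecidable

/-- Euclidean (ℓ2) norm of a finite real vector. -/
noncomputable def norm2 {k : ℕ} (v : Fin k → ℝ) : ℝ := Real.sqrt (∑ i, v i ^ 2)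

/-- ℓ∞ norm (maximum absolute entry) of a finite real vector. -/
noncomputable def normInf {k : ℕ} (v : Fin k → ℝ) : ℝ := ⨆ i, |v i|

/-- Support of a vector, as a finset. -/
noncomputable def spt {k : ℕ} (v : Fin k → ℝ) : Finset (Fin k) :=
  Finset.univ.filter (fun i => v i ≠ 0)

/-- Restriction of a vector to the coordinates indexed by `T` (zero elsewhere). -/
noncomputable def restr {k : ℕ} (T : Finset (Fin k)) (v : Fin k → ℝ) : Fin k → ℝ :=
  fun i => if i ∈ T then v i else 0

/-- `δ ∈ [0,1)` is an `S`-restricted isometry bound for `A`: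
`(1-δ)‖z‖² ≤ ‖Az‖² ≤ (1+δ)‖z‖²` for every `z` with at most `S` nonzero entries. -/
def RIPBound {n m : ℕ} (A : Matrix (Fin n) (Fin m) ℝ) (S : ℕ) (δ : ℝ) : Prop :=
  0 ≤ δ ∧ δ < 1 ∧
    ∀ z : Fin m → ℝ, (spt z).card ≤ S →
      (1 - δ) * (∑ i, z i ^ 2) ≤ (∑ j, (A.mulVec z) j ^ 2) ∧
      (∑ j, (A.mulVec z) j ^ 2) ≤ (1 + δ) * (∑ i, z i ^ 2)

/-- `θ ≥ 0` is an `(S,S')`-restricted orthogonality bound for `A`: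
`|⟨Az, Az'⟩| ≤ θ‖z‖‖z'‖` for all `z, z'` with disjoint supports of cardinalities `≤ S, S'`. -/
def ROBound {n m : ℕ} (A : Matrix (Fin n) (Fin m) ℝ) (S S' : ℕ) (θ : ℝ) : Prop :=
  0 ≤ θ ∧
    ∀ z z' : Fin m → ℝ, Disjoint (spt z) (spt z') →
      (spt z).card ≤ S → (spt z').card ≤ S' →
      |∑ j, (A.mulVec z) j * (A.mulVec z') j| ≤ θ * norm2 z * norm2 z'

/-- A modified-CS estimate with known part `T`: feasible and with minimal ℓ1 norm outside `T`
among all feasible vectors. -/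
def ModCS {n m : ℕ} (A : Matrix (Fin n) (Fin m) ℝ) (y : Fin n → ℝ) (ε : ℝ)
    (T : Finset (Fin m)) (xhat : Fin m → ℝ) : Prop :=
  norm2 (fun j => y j - (A.mulVec xhat) j) ≤ ε ∧
    ∀ β : Fin m → ℝ, norm2 (fun j => y j - (A.mulVec β) j) ≤ ε →
      ∑ i ∈ Tᶜ, |xhat i| ≤ ∑ i ∈ Tᶜ, |β i|

/-- The LS estimate on `T` from `y`: supported on `T` and satisfying the normal equations
`A_Tᵀ (y - A x̂) = 0` (equivalently `x̂_T = (A_Tᵀ A_T)⁻¹ A_Tᵀ y` when `A_T` has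
full column rank). -/
def IsLS {n m : ℕ} (A : Matrix (Fin n) (Fin m) ℝ) (y : Fin n → ℝ)
    (T : Finset (Fin m)) (xhat : Fin m → ℝ) : Prop :=
  (∀ i, i ∉ T → xhat i = 0) ∧
    ∀ i ∈ T, (∑ j, A j i * (y j - (A.mulVec xhat) j)) = 0

/-- `C₁(δ) = 4√(1+δ)/(1-(√2+1)δ)`. -/
noncomputable def C1 (δ : ℝ) : ℝ := 4 * Real.sqrt (1 + δ) / (1 - (Real.sqrt 2 + 1) * δ)

/-- `C₂(δ) = 2(1+(√2-1)δ)/(1-(√2+1)δ)`. -/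
noncomputable def C2 (δ : ℝ) : ℝ := 2 * (1 + (Real.sqrt 2 - 1) * δ) / (1 - (Real.sqrt 2 + 1) * δ)


lemma n2_sq {k : ℕ} (v : Fin k → ℝ) : norm2 v ^ 2 = v ⬝ᵥ v := by
  unfold norm2
  rw [Real.sq_sqrt (Finset.sum_nonneg fun i _ => sq_nonneg _)]
  simp [dotProduct, sq]

lemma n2_nonneg {k : ℕ} (v : Fin k → ℝ) : 0 ≤ norm2 v := Real.sqrt_nonneg _

lemma n2_cs {k : ℕ} (u v : Fin k → ℝ) : |u ⬝ᵥ v| ≤ norm2 u * norm2 v := by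
  apply abs_le_of_sq_le_sq _ (mul_nonneg (n2_nonneg _) (n2_nonneg _))
  rw [mul_pow, n2_sq, n2_sq]
  have := Finset.sum_mul_sq_le_sq_mul_sq Finset.univ u v
  simpa [dotProduct, sq] using this

lemma n2_add {k : ℕ} (u v : Fin k → ℝ) : norm2 (u + v) ≤ norm2 u + norm2 v := by
  apply le_of_sq_le_sq _ (add_nonneg (n2_nonneg _) (n2_nonneg _))
  have h1 := n2_cs u v
  have h2 := le_abs_self (u ⬝ᵥ v)
  have h3 := n2_sq u
  have h4 := n2_sq v
  rw [n2_sq, add_dotProduct, dotProduct_add, dotProduct_add, dotProduct_comm v u]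
  nlinarith

lemma n2_neg {k : ℕ} (u : Fin k → ℝ) : norm2 (-u) = norm2 u := by
  simp [norm2]

lemma restr_union {k : ℕ} {S T : Finset (Fin k)} (h : Disjoint S T) (v : Fin k → ℝ) :
    restr (S ∪ T) v = restr S v + restr T v := by
  funext i
  have : i ∈ S → i ∉ T := fun h1 => Finset.disjoint_left.mp h h1
  simp only [restr, Pi.add_apply, Finset.mem_union]
  by_cases h1 : i ∈ S <;> by_cases h2 : i ∈ T <;> simp_all

lemma spt_restr {k : ℕ} (S : Finset (Fin k)) (v : Fin k → ℝ) : spt (restr S v) ⊆ S := by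
  intro i hi
  by_contra h
  simp [spt, restr, h] at hi

lemma n2_restr_sq {k : ℕ} (S : Finset (Fin k)) (v : Fin k → ℝ) :
    norm2 (restr S v) ^ 2 = ∑ i ∈ S, v i ^ 2 := by
  rw [n2_sq]
  simp [dotProduct, restr, sq]

lemma dot_disj {k : ℕ} {u v : Fin k → ℝ} (h : Disjoint (spt u) (spt v)) : u ⬝ᵥ v = 0 := by
  unfold dotProduct
  apply Finset.sum_eq_zero
  intro i _
  by_contra hne
  have h1 : i ∈ spt u := by
    simp only [spt, Finset.mem_filter, Finset.mem_univ, true_and]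
    exact left_ne_zero_of_mul hne
  have h2 : i ∈ spt v := by
    simp only [spt, Finset.mem_filter, Finset.mem_univ, true_and]
    exact right_ne_zero_of_mul hne
  exact Finset.disjoint_left.mp h h1 h2

lemma spt_comb {k : ℕ} (u v : Fin k → ℝ) (t : ℝ) : spt (u + t • v) ⊆ spt u ∪ spt v := by
  intro i hi
  by_contra h
  simp only [spt, Finset.mem_union, Finset.mem_filter, Finset.mem_univ, true_and] at h hi
  push Not at h
  simp [h.1, h.2] at hi

lemma rip_dot {n m : ℕ} {A : Matrix (Fin n) (Fin m) ℝ} {S : ℕ} {δ : ℝ} (h : RIPBound A S δ)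
    (z : Fin m → ℝ) (hz : (spt z).card ≤ S) :
    (1 - δ) * (z ⬝ᵥ z) ≤ (A.mulVec z) ⬝ᵥ (A.mulVec z) ∧
    (A.mulVec z) ⬝ᵥ (A.mulVec z) ≤ (1 + δ) * (z ⬝ᵥ z) := by
  have := h.2.2 z hz
  simpa [dotProduct, sq] using this

lemma rip_orth {n m : ℕ} {A : Matrix (Fin n) (Fin m) ℝ} {S : ℕ} {δ : ℝ} (h : RIPBound A S δ)
    (u v : Fin m → ℝ) (hd : Disjoint (spt u) (spt v)) (hc : (spt u).card + (spt v).card ≤ S) :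
    |(A.mulVec u) ⬝ᵥ (A.mulVec v)| ≤ δ * norm2 u * norm2 v := by
  have hδ := h.1
  apply abs_le_of_sq_le_sq _ (mul_nonneg (mul_nonneg hδ (n2_nonneg _)) (n2_nonneg _))
  rw [mul_pow, mul_pow, n2_sq, n2_sq]
  have key : ∀ t : ℝ, 0 ≤ (δ * (v ⬝ᵥ v)) * (t * t) +
      (-2 * ((A.mulVec u) ⬝ᵥ (A.mulVec v))) * t + δ * (u ⬝ᵥ u) := by
    intro t
    have hcard : ∀ t : ℝ, (spt (u + t • v)).card ≤ S := fun t =>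
      (Finset.card_le_card (spt_comb u v t)).trans ((Finset.card_union_le _ _).trans hc)
    have h1 := (rip_dot h _ (hcard t)).2
    have h2 := (rip_dot h _ (hcard (-t))).1
    have h0 := dot_disj hd
    simp only [Matrix.mulVec_add, Matrix.mulVec_smul, add_dotProduct, dotProduct_add,
      smul_dotProduct, dotProduct_smul, smul_eq_mul, dotProduct_comm v u, h0,
      dotProduct_comm (A.mulVec v) (A.mulVec u)] at h1 h2
    nlinarith
  have := discrim_le_zero key
  unfold discrim at this
  nlinarith

lemma top_s {k : ℕ} (g : Fin k → ℝ) (U : Finset (Fin k)) (s : ℕ) (hs : s ≤ U.card) :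
    ∃ V ⊆ U, V.card = s ∧ ∀ i ∈ V, ∀ j ∈ U \ V, g j ≤ g i := by
  induction s with
  | zero => exact ⟨∅, by simp, by simp, by simp⟩
  | succ s ih =>
    obtain ⟨V, hVU, hc, hV⟩ := ih (by omega)
    have hne : (U \ V).Nonempty := by
      rw [← Finset.card_pos, Finset.card_sdiff_of_subset hVU]; omega
    obtain ⟨a, ha, hmax⟩ := Finset.exists_max_image (U \ V) g hne
    have ha' := Finset.mem_sdiff.mp ha
    refine ⟨insert a V, ?_, ?_, ?_⟩
    · intro i hi
      rcases Finset.mem_insert.mp hi with rfl | hi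
      · exact ha'.1
      · exact hVU hi
    · rw [Finset.card_insert_of_notMem ha'.2, hc]
    · intro i hi j hj
      simp only [Finset.mem_sdiff, Finset.mem_insert, not_or] at hj
      have hj' : j ∈ U \ V := Finset.mem_sdiff.mpr ⟨hj.1, hj.2.2⟩
      rcases Finset.mem_insert.mp hi with rfl | hi
      · exact hmax j hj'
      · exact hV i hi j hj'

lemma avg_split {k : ℕ} (h : Fin k → ℝ) (U : Finset (Fin k)) (s : ℕ) (hs : 0 < s) :
    ∃ V ⊆ U, V.card ≤ s ∧ (U.card ≤ s → V = U) ∧ (s ≤ U.card → V.card = s) ∧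
      ∀ j ∈ U \ V, |h j| ≤ (∑ i ∈ V, |h i|) / s := by
  rcases le_total U.card s with hle | hle
  · refine ⟨U, subset_rfl, hle, fun _ => rfl, fun h' => le_antisymm hle h', by simp⟩
  · obtain ⟨V, hVU, hc, hV⟩ := top_s (fun i => |h i|) U s hle
    refine ⟨V, hVU, hc.le, ?_, fun _ => hc, ?_⟩
    · intro hle'
      exact Finset.eq_of_subset_of_card_le hVU (by omega)
    · intro j hj
      rw [le_div_iff₀ (by exact_mod_cast hs)]
      have := Finset.card_nsmul_le_sum V (fun i => |h i|) (|h j|) (fun i hi => hV i hi j hj)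
      rw [hc, nsmul_eq_mul] at this
      linarith

lemma block {k : ℕ} (h : Fin k → ℝ) (s : ℕ) (hs : 0 < s) (φ : (Fin k → ℝ) → ℝ)
    (hφ : ∀ a b, φ (a + b) = φ a + φ b) (K : ℝ) (hK : 0 ≤ K) (c : ℕ) :
    ∀ (U : Finset (Fin k)) (M : ℝ), U.card ≤ c → 0 ≤ M → (∀ i ∈ U, |h i| ≤ M) →
    (∀ z, spt z ⊆ U → (spt z).card ≤ s → |φ z| ≤ K * norm2 z) →
    |φ (restr U h)| ≤ K * (√s * M + (∑ i ∈ U, |h i|) / √s) := by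
  induction c with
  | zero =>
    intro U M hc hM hb hz
    have : U = ∅ := by simpa using hc
    subst this
    have h0 : restr ∅ h = 0 := by funext i; simp [restr]
    have h1 : φ 0 = 0 := by have := hφ 0 0; simp at this; exact this
    rw [h0, h1]
    simp
    positivity
  | succ c ih =>
    intro U M hc hM hb hz
    obtain ⟨V, hVU, hVs, hV1, hV2, hV⟩ := avg_split h U s hs
    have hsp : (0:ℝ) < √s := Real.sqrt_pos.mpr (by exact_mod_cast hs)
    have hss : √(s:ℝ) * √(s:ℝ) = s := Real.mul_self_sqrt (by positivity)
    have hVn : norm2 (restr V h) ≤ √s * M := by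
      apply le_of_sq_le_sq _ (by positivity)
      rw [n2_restr_sq, mul_pow, sq (√(s:ℝ)), hss]
      calc ∑ i ∈ V, h i ^ 2 ≤ V.card • M ^ 2 := by
            apply Finset.sum_le_card_nsmul
            intro i hi
            exact sq_le_sq' (by linarith [abs_le.mp (hb i (hVU hi))])
              (by linarith [abs_le.mp (hb i (hVU hi))])
        _ ≤ s * M ^ 2 := by
            rw [nsmul_eq_mul]
            have : (V.card : ℝ) ≤ s := by exact_mod_cast hVs
            gcongr
    have hφV : |φ (restr V h)| ≤ K * (√s * M) :=
      (hz _ ((spt_restr V h).trans hVU) ((Finset.card_le_card (spt_restr V h)).trans hVs)).trans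
        (by gcongr)
    rcases le_total U.card s with hle | hle
    · have := hV1 hle
      subst this
      refine hφV.trans ?_
      have : 0 ≤ (∑ i ∈ V, |h i|) / √s := by positivity
      gcongr
      linarith
    · have hVc := hV2 hle
      have hrec := ih (U \ V) ((∑ i ∈ V, |h i|) / s)
        (by rw [Finset.card_sdiff_of_subset hVU]; omega) (by positivity) hV
        (fun z h1 h2 => hz z (h1.trans Finset.sdiff_subset) h2)
      have hU : restr U h = restr V h + restr (U \ V) h := by
        rw [← restr_union Finset.disjoint_sdiff, Finset.union_sdiff_of_subset hVU]
      have hsum := Finset.sum_sdiff (f := fun i => |h i|) hVU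
      have he : √s * ((∑ i ∈ V, |h i|) / s) = (∑ i ∈ V, |h i|) / √s := by
        nth_rewrite 2 [← hss]; field_simp
      rw [hU, hφ, ← hsum]
      rw [he] at hrec
      calc _ ≤ |φ (restr V h)| + |φ (restr (U \ V) h)| := abs_add_le _ _
        _ ≤ _ := add_le_add hφV hrec
        _ = _ := by ring

lemma key_split {k : ℕ} (h : Fin k → ℝ) (s : ℕ) (U : Finset (Fin k)) (b : ℝ)
    (hb : 0 ≤ b) (hU : ∑ i ∈ U, |h i| ≤ √s * b) :
    ∃ V ⊆ U, V.card ≤ s ∧ ∀ (φ : (Fin k → ℝ) → ℝ), (∀ a b, φ (a + b) = φ a + φ b) →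
      ∀ K : ℝ, 0 ≤ K → (∀ z, spt z ⊆ U \ V → (spt z).card ≤ s → |φ z| ≤ K * norm2 z) →
      |φ (restr (U \ V) h)| ≤ K * b := by
  rcases Nat.eq_zero_or_pos s with rfl | hs
  · refine ⟨∅, by simp, by simp, ?_⟩
    intro φ hφ K hK _
    have hz : ∀ i ∈ U, |h i| = 0 := by
      apply (Finset.sum_eq_zero_iff_of_nonneg (fun i _ => abs_nonneg _)).mp
      apply le_antisymm _ (Finset.sum_nonneg fun i _ => abs_nonneg _)
      simpa using hU
    have h0 : restr (U \ ∅) h = 0 := by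
      funext i
      simp only [restr, Finset.sdiff_empty, Pi.zero_apply, ite_eq_right_iff]
      intro hi
      exact abs_eq_zero.mp (hz i hi)
    have h1 : φ 0 = 0 := by have := hφ 0 0; simp at this; exact this
    rw [h0, h1]
    simp
    positivity
  · obtain ⟨V, hVU, hVs, -, -, hV⟩ := avg_split h U s hs
    refine ⟨V, hVU, hVs, ?_⟩
    intro φ hφ K hK hz
    have hsp : (0:ℝ) < √s := Real.sqrt_pos.mpr (by exact_mod_cast hs)
    have hss : √(s:ℝ) * √(s:ℝ) = s := Real.mul_self_sqrt (by positivity)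
    have hrec := block h s hs φ hφ K hK _ (U \ V) _ le_rfl (by positivity) hV hz
    have hsum := Finset.sum_sdiff (f := fun i => |h i|) hVU
    have he : √s * ((∑ i ∈ V, |h i|) / s) = (∑ i ∈ V, |h i|) / √s := by
      nth_rewrite 2 [← hss]; field_simp
    refine hrec.trans ?_
    gcongr
    rw [he, ← add_div, div_le_iff₀ hsp]
    linarith

lemma final_alg {δ ε a b q r N s2 c X Y : ℝ} (hδ0 : 0 ≤ δ) (hε : 0 ≤ ε)
    (ha : 0 ≤ a) (hb : 0 ≤ b) (hq : 0 ≤ q) (hc : 0 ≤ c) (hs2 : 0 ≤ s2) (hs22 : s2 ^ 2 = 2)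
    (hqq : q ^ 2 = a ^ 2 + b ^ 2) (hr : r ≤ a) (hN : N ≤ q + r)
    (hD : 0 < 1 - (s2 + 1) * δ)
    (hX : X ≤ c * q * (2 * ε)) (hY : Y ≤ δ * (a + b) * a)
    (hm : (1 - δ) * q ^ 2 ≤ X + Y) :
    N ≤ 4 * c / (1 - (s2 + 1) * δ) * ε := by
  have haq : a ≤ q := le_of_sq_le_sq (by nlinarith) hq
  have hab : a + b ≤ s2 * q := by
    apply le_of_sq_le_sq _ (by positivity)
    rw [mul_pow, hs22]
    nlinarith [sq_nonneg (a - b)]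
  have h1 : δ * (a + b) * a ≤ δ * (s2 * q) * q := by gcongr
  have h2 : (1 - (s2 + 1) * δ) * q * q ≤ 2 * c * ε * q := by nlinarith
  have h3 : (1 - (s2 + 1) * δ) * q ≤ 2 * c * ε := by
    rcases hq.eq_or_lt with h | h
    · rw [← h]; simp; positivity
    · exact le_of_mul_le_mul_right h2 h
  rw [div_mul_eq_mul_div, le_div_iff₀ hD]
  have : N ≤ 2 * q := by linarith
  nlinarith

/-- modified-CS error bound (Lemma 1). -/
theorem modCS_error_bound {n m : ℕ} (A : Matrix (Fin n) (Fin m) ℝ)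
    (x : Fin m → ℝ) (w : Fin n → ℝ) (ε δ : ℝ) (T : Finset (Fin m))
    (hw : norm2 w ≤ ε)
    (hδ : δ < Real.sqrt 2 - 1)
    (hRIP : RIPBound A ((spt x).card + ((spt x) \ T).card + (T \ (spt x)).card) δ)
    (xhat : Fin m → ℝ)
    (hxhat : ModCS A (fun j => (A.mulVec x) j + w j) ε T xhat) :
    norm2 (fun i => x i - xhat i) ≤ C1 δ * ε := by
  obtain ⟨hfeas, hmin⟩ := hxhat
  have hε : 0 ≤ ε := (n2_nonneg w).trans hw
  have hδ0 := hRIP.1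
  set s := ((spt x) \ T).card with hs
  set T0 := T ∪ spt x with hT0
  set S := (spt x).card + s + (T \ (spt x)).card with hS
  have hT0c : T0.card + s = S := by
    have : T0.card = (T \ spt x).card + (spt x).card := by
      rw [hT0, Finset.card_sdiff_add_card]
    omega
  have h2s : s + s ≤ S := by
    have : s ≤ (spt x).card := Finset.card_le_card Finset.sdiff_subset
    omega
  let h : Fin m → ℝ := fun i => x i - xhat i
  have hx0 : ∀ i, i ∉ spt x → x i = 0 := by
    intro i hi
    simpa [spt] using hi
  -- cone constraint
  have hcone : ∑ i ∈ T0ᶜ, |h i| ≤ ∑ i ∈ spt x \ T, |h i| := by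
    have h1 := hmin x (by simpa using hw)
    have hsub : T0ᶜ ⊆ Tᶜ := by
      intro i; simp only [hT0, Finset.mem_compl, Finset.mem_union]; tauto
    have hd : Tᶜ \ T0ᶜ = spt x \ T := by
      ext i; simp only [hT0, Finset.mem_sdiff, Finset.mem_compl, Finset.mem_union]; tauto
    rw [← Finset.sum_sdiff hsub, ← Finset.sum_sdiff hsub, hd] at h1
    have h2 : ∑ i ∈ T0ᶜ, |x i| = 0 := by
      apply Finset.sum_eq_zero
      intro i hi
      simp only [hT0, Finset.mem_compl, Finset.mem_union, not_or] at hi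
      rw [hx0 i hi.2, abs_zero]
    have h3 : ∑ i ∈ T0ᶜ, |h i| = ∑ i ∈ T0ᶜ, |xhat i| := by
      apply Finset.sum_congr rfl
      intro i hi
      simp only [hT0, Finset.mem_compl, Finset.mem_union, not_or] at hi
      simp [h, hx0 i hi.2]
    have h4 : ∑ i ∈ spt x \ T, |x i| ≤ ∑ i ∈ spt x \ T, |h i| + ∑ i ∈ spt x \ T, |xhat i| := by
      rw [← Finset.sum_add_distrib]
      apply Finset.sum_le_sum
      intro i _
      have := abs_add_le (h i) (xhat i)
      simpa [h] using this
    linarith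
  have hl1 : ∑ i ∈ T0ᶜ, |h i| ≤ √s * norm2 (restr T0 h) := by
    refine hcone.trans ?_
    apply le_of_sq_le_sq _ (mul_nonneg (Real.sqrt_nonneg _) (n2_nonneg _))
    rw [mul_pow, Real.sq_sqrt (by positivity), n2_restr_sq]
    have h1 := sq_sum_le_card_mul_sum_sq (s := spt x \ T) (f := fun i => |h i|)
    refine h1.trans ?_
    simp only [sq_abs]
    gcongr
    rw [hT0]
    intro i; simp only [Finset.mem_sdiff, Finset.mem_union]; tauto
  obtain ⟨V, hVU, hVs, hkey⟩ := key_split h s T0ᶜ _ (n2_nonneg (restr T0 h)) hl1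
  have hdTV : Disjoint T0 V := Finset.disjoint_left.mpr fun i h1 h2 =>
    (Finset.mem_compl.mp (hVU h2)) h1
  set U := T0ᶜ \ V with hU
  have hUT : Disjoint T0 U := Finset.disjoint_left.mpr fun i h1 h2 =>
    (Finset.mem_compl.mp (Finset.mem_sdiff.mp h2).1) h1
  have hUV : Disjoint V U := Finset.disjoint_sdiff
  have hsplit : h = restr (T0 ∪ V) h + restr U h := by
    rw [← restr_union (Finset.disjoint_union_left.mpr ⟨hUT, hUV⟩)]
    funext i
    have : i ∈ T0 ∪ V ∪ U := by
      simp only [hU, Finset.mem_union, Finset.mem_sdiff, Finset.mem_compl]; tauto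
    simp only [restr, this, if_true]
  have h01 := restr_union hdTV h
  have hqq : norm2 (restr (T0 ∪ V) h) ^ 2 = norm2 (restr T0 h) ^ 2 + norm2 (restr V h) ^ 2 := by
    rw [n2_restr_sq, n2_restr_sq, n2_restr_sq, Finset.sum_union hdTV]
  have hr : norm2 (restr U h) ≤ norm2 (restr T0 h) := by
    have := hkey (fun z => restr U h ⬝ᵥ z) (fun a b => dotProduct_add _ _ _) (norm2 (restr U h))
      (n2_nonneg _) (fun z _ _ => n2_cs _ _)
    simp only [← n2_sq] at this
    have h2 := le_abs_self (norm2 (restr U h) ^ 2)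
    rcases (n2_nonneg (restr U h)).eq_or_lt with h0 | h0
    · rw [← h0]; exact n2_nonneg _
    · exact le_of_mul_le_mul_left (by linarith [sq (norm2 (restr U h))]) h0
  have hY := hkey (fun z => A.mulVec (restr (T0 ∪ V) h) ⬝ᵥ A.mulVec z)
    (fun a b => by simp only [Matrix.mulVec_add, dotProduct_add])
    (δ * (norm2 (restr T0 h) + norm2 (restr V h)))
    (mul_nonneg hδ0 (add_nonneg (n2_nonneg _) (n2_nonneg _)))
    (by
      intro z hz hzs
      have c0 := Finset.card_le_card (spt_restr T0 h)
      have c1 := Finset.card_le_card (spt_restr V h)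
      have e1 := rip_orth hRIP (restr T0 h) z
        (Finset.disjoint_of_subset_left (spt_restr T0 h) (Finset.disjoint_of_subset_right hz hUT))
        (by omega)
      have e2 := rip_orth hRIP (restr V h) z
        (Finset.disjoint_of_subset_left (spt_restr V h) (Finset.disjoint_of_subset_right hz hUV))
        (by omega)
      simp only [h01, Matrix.mulVec_add, add_dotProduct]
      refine (abs_add_le _ _).trans ?_
      linarith)
  have hAh : norm2 (A.mulVec h) ≤ 2 * ε := by
    have e : A.mulVec h = (fun j => (A.mulVec x) j + w j - (A.mulVec xhat) j) + (-w) := by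
      have : h = x - xhat := rfl
      rw [this, Matrix.mulVec_sub]
      funext j
      simp only [Pi.sub_apply, Pi.add_apply, Pi.neg_apply]
      ring
    rw [e]
    refine (n2_add _ _).trans ?_
    rw [n2_neg]
    linarith
  have hcq : (spt (restr (T0 ∪ V) h)).card ≤ S := by
    have := Finset.card_le_card (spt_restr (T0 ∪ V) h)
    have := Finset.card_union_le T0 V
    omega
  obtain ⟨hlo, hhi⟩ := rip_dot hRIP _ hcq
  have hAq : norm2 (A.mulVec (restr (T0 ∪ V) h)) ≤ √(1 + δ) * norm2 (restr (T0 ∪ V) h) := by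
    apply le_of_sq_le_sq _ (mul_nonneg (Real.sqrt_nonneg _) (n2_nonneg _))
    rw [mul_pow, Real.sq_sqrt (by linarith), n2_sq, n2_sq]
    exact hhi
  have hX : A.mulVec (restr (T0 ∪ V) h) ⬝ᵥ A.mulVec h
      ≤ √(1 + δ) * norm2 (restr (T0 ∪ V) h) * (2 * ε) := by
    refine (le_abs_self _).trans ((n2_cs _ _).trans ?_)
    exact mul_le_mul hAq hAh (n2_nonneg _) (mul_nonneg (Real.sqrt_nonneg _) (n2_nonneg _))
  have hN : norm2 h ≤ norm2 (restr (T0 ∪ V) h) + norm2 (restr U h) := by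
    have := n2_add (restr (T0 ∪ V) h) (restr U h)
    rwa [← hsplit] at this
  have hm : (1 - δ) * norm2 (restr (T0 ∪ V) h) ^ 2 ≤ A.mulVec (restr (T0 ∪ V) h) ⬝ᵥ A.mulVec h
      + -(A.mulVec (restr (T0 ∪ V) h) ⬝ᵥ A.mulVec (restr U h)) := by
    have e : A.mulVec h = A.mulVec (restr (T0 ∪ V) h) + A.mulVec (restr U h) := by
      rw [← Matrix.mulVec_add, ← hsplit]
    rw [e, dotProduct_add, n2_sq]
    linarith
  have h2 : √(2:ℝ) ^ 2 = 2 := Real.sq_sqrt (by norm_num)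
  have hD : 0 < 1 - (√2 + 1) * δ := by
    nlinarith [Real.sqrt_nonneg 2]
  exact final_alg hδ0 hε (n2_nonneg (restr T0 h)) (n2_nonneg (restr V h)) (n2_nonneg _)
    (Real.sqrt_nonneg _) (Real.sqrt_nonneg _) h2 hqq hr hN hD hX
    ((neg_le_abs _).trans hY) hm
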